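/- arXiv:1603.04076 — 8 statements merged into one kernel-verified Lean document; each statement's English description precedes it below -/
import Mathlib

section
/- Let p be a prime number, let F be a field of characteristic p, let r be a natural number, and let W be a finite-dimensional 𝔽_p-vector space. For i = 1, …, r let f_i : W → F be an 𝔽_p-linear map (F viewed as an 𝔽_p-vector space). If dim_{𝔽_p} W > r/(p − 1), then for all x_1, …, x_r ∈ F one has ∑_{w ∈ W} (x_1 + f_1(w)) ⋯ (x_r + f_r(w)) = 0. -/
namespace MvPolynomial

/-- A polynomial of small total degree with coefficients in an extension `A` of a finite
field `K` sums to zero over the `K`-rational points of affine space. -/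
theorem sum_eval_algebraMap_eq_zero {K A σ : Type*} [Field K] [Fintype K] [CommRing A]
    [Algebra K A] [Fintype σ] [DecidableEq σ] (P : MvPolynomial σ A)
    (h : P.totalDegree < (Fintype.card K - 1) * Fintype.card σ) :
    ∑ c : σ → K, eval (fun j => algebraMap K A (c j)) P = 0 := by
  simp_rw [eval_eq']
  rw [Finset.sum_comm]
  refine Finset.sum_eq_zero fun d hd => ?_
  rw [← Finset.mul_sum]
  have hmon := sum_eval_eq_zero (monomial d (1 : K)) <|
    (totalDegree_monomial_le d (1 : K)).trans_lt ((le_totalDegree hd).trans_lt h)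
  have hmap := congrArg (algebraMap K A) hmon
  simp only [map_sum, eval_monomial, one_mul, Finsupp.prod_pow, map_prod, map_pow,
    map_zero] at hmap
  rw [hmap, mul_zero]

end MvPolynomial


/-- Goss, Lemma 8.8.1. Let `F` be a field of characteristic `p`
(viewed as an `𝔽_p`-vector space), `W` a finite dimensional `𝔽_p`-vector space and
`f i : W → F` `𝔽_p`-linear maps, `i = 1, …, r`. If `dim_{𝔽_p} W > r / (p - 1)`, then
for all `x₁, …, x_r ∈ F` one has `∑_{w ∈ W} (x₁ + f₁ w) ⋯ (x_r + f_r w) = 0`. -/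
theorem stmt_2 (p : ℕ) [Fact p.Prime] (F : Type*) [Field F] [CharP F p]
    [Algebra (ZMod p) F]
    (r : ℕ) (W : Type*) [AddCommGroup W] [Module (ZMod p) W]
    [FiniteDimensional (ZMod p) W]
    (f : Fin r → W →ₗ[ZMod p] F)
    (hdim : r < Module.finrank (ZMod p) W * (p - 1))
    (x : Fin r → F) :
    ∑ᶠ w : W, ∏ i, (x i + f i w) = 0 := by
  classical
  let b := Module.finBasis (ZMod p) W
  let P : MvPolynomial (Fin (Module.finrank (ZMod p) W)) F :=
    ∏ i, (MvPolynomial.C (x i) + ∑ j, MvPolynomial.C (f i (b j)) * MvPolynomial.X j)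
  have hP : P.totalDegree ≤ r := by
    refine (MvPolynomial.totalDegree_finsetProd _ _).trans ?_
    refine (Finset.sum_le_card_nsmul _ _ 1 fun i _ => ?_).trans (by simp)
    refine (MvPolynomial.totalDegree_add _ _).trans (max_le (by simp) ?_)
    refine MvPolynomial.totalDegree_finsetSum_le fun j _ => ?_
    refine (MvPolynomial.totalDegree_mul _ _).trans ?_
    simp
  have hsum := MvPolynomial.sum_eval_algebraMap_eq_zero (K := ZMod p) P <| by
    rw [ZMod.card, Fintype.card_fin, mul_comm]
    exact hP.trans_lt hdim
  rw [← finsum_comp_equiv b.equivFun.symm.toEquiv, finsum_eq_sum_of_fintype, ← hsum]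
  refine Finset.sum_congr rfl fun c _ => ?_
  simp [P, map_prod, b.equivFun_symm_apply, Algebra.smul_def, mul_comm]
end

section
/- Let q be a power of a prime p and 𝔽_q the field with q elements. Let F be a commutative 𝔽_q-algebra, let s be a natural number, let t_1, …, t_s ∈ F, and let d be a natural number with d(q − 1) > s. Then ∑_{a ∈ A_{+,d}} a(t_1) ⋯ a(t_s) = 0 in F, where a(t) denotes the evaluation of the polynomial a at t ∈ F via the 𝔽_q-algebra structure of F. -/
open Polynomial in
/-- The monic polynomials of degree `d` are parametrized by their `d` lower coefficients. -/
theorem range_X_pow_add_sum (R : Type*) [CommRing R] [Nontrivial R] (d : ℕ) :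
    Set.range (fun x : Fin d → R ↦ (X ^ d + ∑ j, C (x j) * X ^ (j : ℕ) : R[X])) =
      {a | a.Monic ∧ a.natDegree = d} := by
  ext a
  constructor
  · rintro ⟨x, rfl⟩
    have h := degree_sum_fin_lt x
    refine ⟨monic_X_pow_add h, ?_⟩
    rw [natDegree_add_eq_left_of_degree_lt (by rwa [degree_X_pow]), natDegree_X_pow]
  · rintro ⟨ha, rfl⟩
    refine ⟨fun j ↦ a.coeff j, ?_⟩
    conv_rhs => rw [ha.as_sum]
    simp only [Finset.sum_range]

open Polynomial in
theorem injective_X_pow_add_sum (R : Type*) [CommRing R] (d : ℕ) :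
    Function.Injective
      (fun x : Fin d → R ↦ (X ^ d + ∑ j, C (x j) * X ^ (j : ℕ) : R[X])) := by
  intro x y h
  ext k
  have := congrArg (fun a ↦ coeff a k) (add_left_cancel h)
  simpa [finsetSum_coeff, coeff_C_mul, coeff_X_pow, Fin.val_inj] using this

/-- A product of fewer than `n (q - 1)` affine forms in `n` variables, with coefficients in an
algebra over a field with `q` elements, sums to zero over all points with values in that field. -/
theorem sum_prod_affine_eq_zero {K F σ ι : Type*} [Field K] [Fintype K] [CommRing F] [Algebra K F]
    [Fintype σ] [DecidableEq σ] [Fintype ι] [DecidableEq ι] (c : ι → F) (u : ι → σ → F)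
    (h : Fintype.card ι < (Fintype.card K - 1) * Fintype.card σ) :
    ∑ x : σ → K, ∏ i, (c i + ∑ j, algebraMap K F (x j) * u i j) = 0 := by
  let m : Option σ → MvPolynomial σ K := fun o ↦ o.elim 1 MvPolynomial.X
  let w : ι → Option σ → F := fun i o ↦ o.elim (c i) (u i)
  have expand (x : σ → K) : ∏ i, (c i + ∑ j, algebraMap K F (x j) * u i j) =
      ∑ g : ι → Option σ,
        algebraMap K F (MvPolynomial.eval x (∏ i, m (g i))) * ∏ i, w i (g i) := by
    have (i : ι) : c i + ∑ j, algebraMap K F (x j) * u i j =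
        ∑ o, algebraMap K F (MvPolynomial.eval x (m o)) * w i o := by
      simp [Fintype.sum_option, m, w]
    simp only [this, Finset.prod_univ_sum, Fintype.piFinset_univ, Finset.prod_mul_distrib,
      map_prod]
  have hdeg (g : ι → Option σ) : (∏ i, m (g i)).totalDegree ≤ Fintype.card ι := by
    refine (MvPolynomial.totalDegree_finsetProd _ _).trans ?_
    refine (Finset.sum_le_card_nsmul _ _ 1 fun i _ ↦ ?_).trans (by simp)
    cases hg : g i <;> simp [m]
  simp only [expand]
  rw [Finset.sum_comm]
  refine Finset.sum_eq_zero fun g _ ↦ ?_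
  rw [← Finset.sum_mul, ← map_sum,
    MvPolynomial.sum_eval_eq_zero _ ((hdeg g).trans_lt h), map_zero, zero_mul]

/-- Let `q = p^f` and `𝔽_q` the field with `q` elements, `F` a
commutative `𝔽_q`-algebra, `t₁, …, t_s ∈ F` and `d` with `d (q - 1) > s`.
Then `∑_{a monic, deg a = d} a(t₁) ⋯ a(t_s) = 0` in `F`. -/
theorem stmt_3 (p f q : ℕ) (hp : p.Prime) (hf : 0 < f) (hq : q = p ^ f)
    (Fq : Type*) [Field Fq] [Fintype Fq] (hcard : Fintype.card Fq = q)
    (F : Type*) [CommRing F] [Algebra Fq F]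
    (s : ℕ) (t : Fin s → F) (d : ℕ) (hd : s < d * (q - 1)) :
    ∑ᶠ a ∈ {a : Polynomial Fq | a.Monic ∧ a.natDegree = d},
      ∏ i, Polynomial.aeval (t i) a = 0 := by
  subst hcard
  rw [← range_X_pow_add_sum, finsum_mem_range (injective_X_pow_add_sum Fq d),
    finsum_eq_sum_of_fintype]
  simpa using sum_prod_affine_eq_zero (K := Fq) (fun i ↦ t i ^ d)
    (fun i (j : Fin d) ↦ t i ^ (j : ℕ)) (by simpa [mul_comm] using hd)
end

section
/- Let q be a power of a prime p and 𝔽_q the field with q elements. Let n and d be natural numbers such that d(q − 1) > ℓ_q(n), where ℓ_q(n) is the sum of the digits of n in base q. Then ∑_{a ∈ A_{+,d}} a^n = 0 in the polynomial ring 𝔽_q[X]. -/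
/-- A power-sum vanishing criterion over a finite field `K`: a polynomial of small total degree
with coefficients in a commutative `K`-algebra sums to zero over all `K`-rational points. -/
theorem MvPolynomial.sum_eval_algebraMap_eq_zero_s4 {K R σ : Type*} [Field K] [Fintype K]
    [CommRing R] [Algebra K R] [Fintype σ] [DecidableEq σ] (P : MvPolynomial σ R)
    (h : P.totalDegree < (Fintype.card K - 1) * Fintype.card σ) :
    ∑ c : σ → K, MvPolynomial.eval (fun j => algebraMap K R (c j)) P = 0 := by
  simp_rw [MvPolynomial.eval_eq]
  rw [Finset.sum_comm]
  refine Finset.sum_eq_zero fun m hm => ?_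
  rw [← Finset.mul_sum]
  have key : ∑ c : σ → K, MvPolynomial.eval c (MvPolynomial.monomial m (1 : K)) = 0 := by
    refine MvPolynomial.sum_eval_eq_zero _ (lt_of_le_of_lt ?_ h)
    rw [MvPolynomial.totalDegree_monomial _ one_ne_zero]
    exact MvPolynomial.le_totalDegree hm
  have := congrArg (algebraMap K R) key
  simp only [MvPolynomial.eval_monomial, one_mul, map_sum, map_zero, Finsupp.prod_pow, map_prod,
    map_pow] at this
  have h2 : ∀ c : σ → K, ∏ i ∈ m.support, algebraMap K R (c i) ^ m i =
      ∏ i, algebraMap K R (c i) ^ m i := fun c =>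
    Finset.prod_subset (Finset.subset_univ _) fun i _ hi => by
      rw [Finsupp.notMem_support_iff.mp hi, pow_zero]
  simp_rw [h2, this, mul_zero]

/-- Over a field `K` with `q` elements, the `n`-th power of an affine form agrees on `K`-rational
points with a polynomial of total degree at most the sum of the base-`q` digits of `n`. -/
theorem exists_mvPolynomial_eval_eq_affine_pow {K R σ : Type*} [Field K] [Fintype K]
    [CommRing R] [Algebra K R] [Fintype σ] (n : ℕ) (a : R) (b : σ → R) :
    ∃ P : MvPolynomial σ R, P.totalDegree ≤ (Nat.digits (Fintype.card K) n).sum ∧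
      ∀ c : σ → K, MvPolynomial.eval (fun j => algebraMap K R (c j)) P =
        (a + ∑ j, algebraMap K R (c j) * b j) ^ n := by
  induction n using Nat.strong_induction_on generalizing a b with
  | _ n ih =>
    rcases Nat.eq_zero_or_pos n with rfl | hn
    · exact ⟨1, by simp, by simp⟩
    have hq : 1 < Fintype.card K := Fintype.one_lt_card
    obtain ⟨Q, hQ, hQe⟩ := ih (n / Fintype.card K) (Nat.div_lt_self hn hq)
      (a ^ Fintype.card K) (fun j => b j ^ Fintype.card K)
    let L : MvPolynomial σ R :=
      MvPolynomial.C a + ∑ j, MvPolynomial.X j * MvPolynomial.C (b j)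
    have hL : L.totalDegree ≤ 1 := by
      refine (MvPolynomial.totalDegree_add _ _).trans (max_le (by simp) ?_)
      refine MvPolynomial.totalDegree_finsetSum_le fun j _ => ?_
      refine (MvPolynomial.totalDegree_mul _ _).trans ?_
      rw [MvPolynomial.totalDegree_C, add_zero]
      refine (MvPolynomial.totalDegree_monomial_le _ _).trans ?_
      simp
    refine ⟨L ^ (n % Fintype.card K) * Q, ?_, fun c => ?_⟩
    · rw [Nat.digits_def' hq hn, List.sum_cons]
      refine (MvPolynomial.totalDegree_mul _ _).trans (add_le_add ?_ hQ)
      refine (MvPolynomial.totalDegree_pow _ _).trans ?_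
      exact (Nat.mul_le_mul_left _ hL).trans (mul_one _).le
    · have hfrob : a ^ Fintype.card K + ∑ j, algebraMap K R (c j) * b j ^ Fintype.card K =
          (a + ∑ j, algebraMap K R (c j) * b j) ^ Fintype.card K := by
        have := map_add (FiniteField.frobeniusAlgHom K R) a (∑ j, algebraMap K R (c j) * b j)
        simp only [map_sum, map_mul, AlgHom.commutes] at this
        simpa [FiniteField.coe_frobeniusAlgHom] using this.symm
      rw [map_mul, map_pow, hQe, hfrob, ← pow_mul]
      simp only [L, map_add, map_sum, map_mul, MvPolynomial.eval_C, MvPolynomial.eval_X]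
      rw [← pow_add, Nat.mod_add_div]

/-- Let `q = p^f` and `𝔽_q` the field with `q` elements, and let
`n, d` be natural numbers with `d (q - 1) > ℓ_q(n)` where `ℓ_q(n)` is the sum of the
base-`q` digits of `n`. Then `∑_{a monic, deg a = d} a ^ n = 0` in `𝔽_q[X]`. -/
theorem stmt_4 (p f q : ℕ) (hp : p.Prime) (hf : 0 < f) (hq : q = p ^ f)
    (Fq : Type*) [Field Fq] [Fintype Fq] (hcard : Fintype.card Fq = q)
    (n d : ℕ) (hd : (Nat.digits q n).sum < d * (q - 1)) :
    ∑ᶠ a ∈ {a : Polynomial Fq | a.Monic ∧ a.natDegree = d}, a ^ n = 0 := by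
  subst hcard
  obtain ⟨P, hP, hPe⟩ := exists_mvPolynomial_eval_eq_affine_pow (K := Fq) n
    (Polynomial.X ^ d : Polynomial Fq) (fun j : Fin d => Polynomial.X ^ (j : ℕ))
  have key := MvPolynomial.sum_eval_algebraMap_eq_zero_s4 (K := Fq) P
    (hP.trans_lt (by rwa [Fintype.card_fin, mul_comm]))
  simp_rw [hPe] at key
  let e : ↥{a : Polynomial Fq | a.Monic ∧ a.natDegree = d} ≃ (Fin d → Fq) :=
    (Polynomial.monicEquivDegreeLT d).trans (Polynomial.degreeLTEquiv Fq d).toEquiv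
  rw [← finsum_set_coe_eq_finsum_mem, ← finsum_comp_equiv e.symm, finsum_eq_sum_of_fintype, ← key]
  refine Finset.sum_congr rfl fun c _ => ?_
  congr 1
  simp [e, Polynomial.monicEquivDegreeLT, Polynomial.degreeLTEquiv,
    ← Polynomial.C_mul_X_pow_eq_monomial]
end

section
/- Let p be a prime, q = p^f, and 𝔽_q the field with q elements. Let F be a field of characteristic p, let s be a natural number, and for i = 1, …, s let ρ_i : 𝔽_q[X] → F be a ring homomorphism. If m is a natural number with m · f · (p − 1) > s, then ∑_{a ∈ A_{+,m}} ρ_1(a) ⋯ ρ_s(a) = 0 in F. -/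
/-- A product of `s` affine functions on a finite `ZMod p`-vector space `V`, with values in a
commutative `ZMod p`-algebra, sums to zero over `V` as soon as `s < (p - 1) * dim V`. -/
theorem sum_prod_add_linearMap_eq_zero {p : ℕ} [Fact p.Prime] {V : Type*} [AddCommGroup V]
    [Module (ZMod p) V] [Fintype V] {F : Type*} [CommRing F] [Algebra (ZMod p) F]
    {ι : Type*} [Fintype ι] (c : ι → F) (L : ι → V →ₗ[ZMod p] F)
    (h : Fintype.card ι < (p - 1) * Module.finrank (ZMod p) V) :
    ∑ v, ∏ i, (c i + L i v) = 0 := by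
  classical
  let b := Module.finBasis (ZMod p) V
  let coef (i : ι) (o : Option (Fin (Module.finrank (ZMod p) V))) : F :=
    o.elim (c i) fun j => L i (b j)
  let P (κ : ι → Option (Fin (Module.finrank (ZMod p) V))) :
      MvPolynomial (Fin (Module.finrank (ZMod p) V)) (ZMod p) :=
    ∏ i, (κ i).elim 1 MvPolynomial.X
  have hP (κ) : ∑ t, MvPolynomial.eval t (P κ) = 0 := by
    apply MvPolynomial.sum_eval_eq_zero
    rw [ZMod.card, Fintype.card_fin]
    refine lt_of_le_of_lt ?_ h
    refine (MvPolynomial.totalDegree_finsetProd _ _).trans ?_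
    refine (Finset.sum_le_card_nsmul _ _ 1 fun i _ => ?_).trans (by simp)
    cases κ i <;> simp
  have hterm (t : Fin (Module.finrank (ZMod p) V) → ZMod p) :
      ∏ i, (c i + L i (b.equivFun.symm t)) =
        ∑ κ : ι → Option (Fin (Module.finrank (ZMod p) V)),
          MvPolynomial.eval t (P κ) • ∏ i, coef i (κ i) := by
    have hi (i : ι) : c i + L i (b.equivFun.symm t) = ∑ o, o.elim 1 t • coef i o := by
      simp [Fintype.sum_option, coef, Module.Basis.equivFun_symm_apply]
    simp_rw [hi, Finset.prod_univ_sum, Fintype.piFinset_univ, P, map_prod]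
    refine Finset.sum_congr rfl fun κ _ => ?_
    rw [← Finset.prod_smul]
    refine Finset.prod_congr rfl fun i _ => ?_
    cases κ i <;> simp
  rw [← b.equivFun.symm.toEquiv.sum_comp]
  simp only [LinearEquiv.coe_toEquiv, hterm]
  rw [Finset.sum_comm]
  simp [← Finset.sum_smul, hP]

/-- A sum over the monic polynomials of degree `m` is a sum over the lower-order terms. -/
theorem finsum_mem_monic_natDegree_eq {R M : Type*} [Ring R] [Nontrivial R] [AddCommMonoid M]
    (m : ℕ) [Fintype (Polynomial.degreeLT R m)] (g : Polynomial R → M) :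
    ∑ᶠ a ∈ {a : Polynomial R | a.Monic ∧ a.natDegree = m}, g a =
      ∑ v : Polynomial.degreeLT R m, g (Polynomial.X ^ m + (v : Polynomial R)) := by
  rw [← finsum_eq_sum_of_fintype, ← finsum_subtype_eq_finsum_cond]
  exact (finsum_comp_equiv (Polynomial.monicEquivDegreeLT m).symm).symm


/-- Let `q = p^f`, `𝔽_q` the field with `q` elements, `F` a field of
characteristic `p`, and `ρ₁, …, ρ_s : 𝔽_q[X] → F` ring homomorphisms. If
`m · f · (p - 1) > s`, then `∑_{a monic, deg a = m} ρ₁(a) ⋯ ρ_s(a) = 0` in `F`. -/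
theorem stmt_6 (p f q : ℕ) (hp : p.Prime) (hf : 0 < f) (hq : q = p ^ f)
    (Fq : Type*) [Field Fq] [Fintype Fq] (hcard : Fintype.card Fq = q)
    (F : Type*) [Field F] [CharP F p]
    (s : ℕ) (ρ : Fin s → Polynomial Fq →+* F)
    (m : ℕ) (hm : s < m * f * (p - 1)) :
    ∑ᶠ a ∈ {a : Polynomial Fq | a.Monic ∧ a.natDegree = m},
      ∏ i, ρ i a = 0 := by
  have : Fact p.Prime := ⟨hp⟩
  have : CharP Fq p := charP_of_card_eq_prime_pow (hcard.trans hq)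
  let := ZMod.algebra Fq p
  let := ZMod.algebra F p
  let e := Polynomial.degreeLTEquiv Fq m
  let := Fintype.ofEquiv _ e.toEquiv.symm
  have hrank : Module.finrank (ZMod p) (Polynomial.degreeLT Fq m) = f * m := by
    refine Nat.pow_right_injective hp.two_le ?_
    dsimp only
    have hV := Module.card_eq_pow_finrank (K := ZMod p) (V := Polynomial.degreeLT Fq m)
    rw [ZMod.card, Fintype.card_congr e.toEquiv] at hV
    simp [← hV, hcard, hq, pow_mul]
  rw [finsum_mem_monic_natDegree_eq]
  simp_rw [map_add]
  refine sum_prod_add_linearMap_eq_zero (p := p) _ (fun i => AddMonoidHom.toZModLinearMap p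
    ((ρ i).toAddMonoidHom.comp (Polynomial.degreeLT Fq m).subtype.toAddMonoidHom)) ?_
  rw [hrank, Fintype.card_fin]
  linarith [mul_comm m f, mul_comm (p - 1) (f * m)]
end

section
/- Let p be a prime, q = p^f, and 𝔽_q the field with q elements. Let F be a field of characteristic p, let s be a natural number, and for i = 1, …, s let ρ_i : 𝔽_q[X] → F be a ring homomorphism. Let b ∈ 𝔽_q[X] be a nonzero polynomial and c ∈ 𝔽_q[X] arbitrary. If m is a natural number with (m − deg b) · f · (p − 1) > s, then ∑_{a ∈ A_{+,m}, a ≡ c (mod b)} ρ_1(a) ⋯ ρ_s(a) = 0 in F, where the sum ranges over all monic polynomials a of degree m congruent to c modulo b. -/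
/-- A polynomial of total degree less than `(p - 1) n` in `n` variables over an extension `F` of
`𝔽_p` sums to zero over the `𝔽_p`-rational points. -/
theorem MvPolynomial.sum_eval_algebraMap_zmod_eq_zero {p : ℕ} [Fact p.Prime] {F : Type*} [Field F]
    [Algebra (ZMod p) F] {σ : Type*} [Fintype σ] [DecidableEq σ] (P : MvPolynomial σ F)
    (hP : P.totalDegree < (p - 1) * Fintype.card σ) :
    ∑ x : σ → ZMod p, MvPolynomial.eval (fun j => algebraMap (ZMod p) F (x j)) P = 0 := by
  simp_rw [MvPolynomial.eval_eq']
  rw [Finset.sum_comm]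
  refine Finset.sum_eq_zero fun e he => ?_
  rw [← Finset.mul_sum]
  have h := MvPolynomial.sum_eval_eq_zero (MvPolynomial.monomial e (1 : ZMod p)) (by
    rw [ZMod.card, MvPolynomial.totalDegree_monomial _ one_ne_zero]
    exact (MvPolynomial.le_totalDegree he).trans_lt hP)
  have h' := congrArg (algebraMap (ZMod p) F) h
  simp only [map_sum, map_zero, MvPolynomial.eval_monomial, one_mul, Finsupp.prod_fintype,
    pow_zero, implies_true, map_prod, map_pow] at h'
  rw [h', mul_zero]

/-- A product of `s` affine maps on a finite `𝔽_p`-space of dimension greater than `s / (p - 1)`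
sums to zero. -/
theorem sum_prod_add_linearMap_zmod_eq_zero {p : ℕ} [Fact p.Prime] {F : Type*} [Field F]
    [Algebra (ZMod p) F] {V : Type*} [AddCommGroup V] [Module (ZMod p) V] [Fintype V]
    {ι : Type*} [Fintype ι] (α : ι → F) (φ : ι → V →ₗ[ZMod p] F)
    (h : Fintype.card ι < (p - 1) * Module.finrank (ZMod p) V) :
    ∑ v, ∏ i, (α i + φ i v) = 0 := by
  classical
  let B := Module.finBasis (ZMod p) V
  let L : ι → MvPolynomial (Fin (Module.finrank (ZMod p) V)) F := fun i =>
    MvPolynomial.C (α i) + ∑ j, MvPolynomial.C (φ i (B j)) * MvPolynomial.X j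
  have hL (i : ι) : (L i).totalDegree ≤ 1 := by
    refine (MvPolynomial.totalDegree_add _ _).trans (max_le (by simp) ?_)
    refine MvPolynomial.totalDegree_finsetSum_le fun j _ => ?_
    refine (MvPolynomial.totalDegree_mul _ _).trans ?_
    simp
  have hdeg : (∏ i, L i).totalDegree ≤ Fintype.card ι := by
    refine (MvPolynomial.totalDegree_finsetProd _ _).trans ?_
    exact (Finset.sum_le_sum fun i _ => hL i).trans (by simp)
  have key := MvPolynomial.sum_eval_algebraMap_zmod_eq_zero (∏ i, L i)
    (by simpa using hdeg.trans_lt h)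
  rw [← key]
  refine Fintype.sum_equiv B.equivFun.toEquiv _ _ fun v => ?_
  rw [map_prod]
  refine Finset.prod_congr rfl fun i _ => ?_
  have hv : φ i v = ∑ j, algebraMap (ZMod p) F (B.equivFun v j) * φ i (B j) := by
    conv_lhs => rw [← B.sum_equivFun v]
    simp only [map_sum, map_smul, Algebra.smul_def]
  simp [L, hv, mul_comm]

namespace Polynomial

/-- Residue classes modulo `b` contain monic polynomials of every degree above that of `b`. -/
theorem exists_monic_natDegree_eq_dvd_sub {K : Type*} [Field K] {b : K[X]} (c : K[X]) (hb : b ≠ 0)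
    {m : ℕ} (hm : b.natDegree < m) : ∃ a : K[X], a.Monic ∧ a.natDegree = m ∧ b ∣ a - c := by
  have hr : ((X ^ m - c) % b).degree < (m : WithBot ℕ) :=
    (EuclideanDomain.mod_lt _ hb).trans ((natDegree_lt_iff_degree_lt hb).1 hm)
  have hr' : (-((X ^ m - c) % b)).degree < (m : WithBot ℕ) := by rwa [degree_neg]
  refine ⟨X ^ m + -((X ^ m - c) % b), monic_X_pow_add hr', ?_, (X ^ m - c) / b, ?_⟩
  · exact natDegree_eq_of_degree_eq_some
      ((degree_add_eq_left_of_degree_lt (by rwa [degree_X_pow])).trans (degree_X_pow m))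
  · linear_combination -(EuclideanDomain.div_add_mod (X ^ m - c) b)

/-- The monic polynomials of degree `m` in a residue class modulo `b` are the translates of one of
them by the multiples `b * h` with `deg h < m - deg b`. -/
theorem bijOn_degreeLT_monic_natDegree_eq_dvd_sub {K : Type*} [Field K] {a₀ b c : K[X]}
    (hb : b ≠ 0) {m : ℕ} (hm : b.natDegree < m) (ha₀ : a₀.Monic) (hdeg : a₀.natDegree = m)
    (hdvd : b ∣ a₀ - c) :
    Set.BijOn (fun h => a₀ + b * h) (degreeLT K (m - b.natDegree))
      {a : K[X] | a.Monic ∧ a.natDegree = m ∧ b ∣ a - c} := by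
  have hlt {h : K[X]} : h ∈ degreeLT K (m - b.natDegree) ↔ (b * h).degree < a₀.degree := by
    rw [mem_degreeLT, degree_eq_natDegree ha₀.ne_zero, hdeg]
    rcases eq_or_ne h 0 with rfl | hh
    · simp
    · rw [degree_mul, degree_eq_natDegree hb, degree_eq_natDegree hh]
      norm_cast
      omega
  refine ⟨fun h hh => ?_, fun h₁ _ h₂ _ heq => ?_, fun a ⟨ha, had, hac⟩ => ?_⟩
  · have hh' := hlt.1 hh
    refine ⟨ha₀.add_of_left hh', ?_, ?_⟩
    · rw [← hdeg]
      exact natDegree_eq_of_degree_eq (degree_add_eq_left_of_degree_lt hh')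
    · rw [add_sub_right_comm]
      exact dvd_add hdvd (dvd_mul_right _ _)
  · exact mul_left_cancel₀ hb (add_left_cancel heq)
  · obtain ⟨h, hh⟩ : b ∣ a - a₀ := by simpa using dvd_sub hac hdvd
    refine ⟨h, hlt.2 ?_, by simp [← hh]⟩
    rw [← hh]
    have hd : a.degree = a₀.degree := by
      rw [degree_eq_natDegree ha.ne_zero, degree_eq_natDegree ha₀.ne_zero, had, hdeg]
    exact hd ▸ degree_sub_lt_left hd ha.ne_zero (by rw [ha.leadingCoeff, ha₀.leadingCoeff])

end Polynomial


/-- Let `q = p^f`, `𝔽_q` the field with `q` elements, `F` a field of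
characteristic `p`, `ρ₁, …, ρ_s : 𝔽_q[X] → F` ring homomorphisms, `b ≠ 0` and `c` in
`𝔽_q[X]`. If `(m - deg b) · f · (p - 1) > s`, then the sum of `ρ₁(a) ⋯ ρ_s(a)` over the
monic polynomials `a` of degree `m` with `a ≡ c (mod b)` vanishes in `F`. -/
theorem stmt_7 (p f q : ℕ) (hp : p.Prime) (hf : 0 < f) (hq : q = p ^ f)
    (Fq : Type*) [Field Fq] [Fintype Fq] (hcard : Fintype.card Fq = q)
    (F : Type*) [Field F] [CharP F p]
    (s : ℕ) (ρ : Fin s → Polynomial Fq →+* F)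
    (b c : Polynomial Fq) (hb : b ≠ 0)
    (m : ℕ) (hm : s < (m - b.natDegree) * f * (p - 1)) :
    ∑ᶠ a ∈ {a : Polynomial Fq | a.Monic ∧ a.natDegree = m ∧ b ∣ (a - c)},
      ∏ i, ρ i a = 0 := by
  classical
  subst hq
  have : Fact p.Prime := ⟨hp⟩
  have hmb : b.natDegree < m := by
    by_contra! h
    simp [Nat.sub_eq_zero_of_le h] at hm
  have : CharP Fq p := charP_of_card_eq_prime_pow hcard
  let : Algebra (ZMod p) Fq := ZMod.algebra Fq p
  let : Algebra (ZMod p) F := ZMod.algebra F p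
  set d := m - b.natDegree
  have hrank : Module.finrank (ZMod p) (Fin d → Fq) = d * f := by
    have h := Module.card_eq_pow_finrank (K := ZMod p) (V := Fin d → Fq)
    rw [Fintype.card_fun, hcard, ZMod.card, Fintype.card_fin, ← pow_mul] at h
    rw [mul_comm, Nat.pow_right_injective hp.two_le h]
  obtain ⟨a₀, ha₀, hdeg, hdvd⟩ := Polynomial.exists_monic_natDegree_eq_dvd_sub c hb hmb
  have hbij := Polynomial.bijOn_degreeLT_monic_natDegree_eq_dvd_sub hb hmb ha₀ hdeg hdvd
  let g : (Fin d → Fq) →+ Polynomial Fq :=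
    (Polynomial.degreeLT Fq d).subtype.toAddMonoidHom.comp
      (Polynomial.degreeLTEquiv Fq d).symm.toLinearMap.toAddMonoidHom
  have hg : Set.BijOn g Set.univ (Polynomial.degreeLT Fq d) :=
    ⟨fun v _ => ((Polynomial.degreeLTEquiv Fq d).symm v).2,
      (Subtype.val_injective.comp (Polynomial.degreeLTEquiv Fq d).symm.injective).injOn,
      fun h hh => ⟨Polynomial.degreeLTEquiv Fq d ⟨h, hh⟩, trivial, by simp [g]⟩⟩
  let φ : Fin s → (Fin d → Fq) →ₗ[ZMod p] F := fun i =>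
    ((AddMonoidHom.mulLeft (ρ i b)).comp ((ρ i).toAddMonoidHom.comp g)).toZModLinearMap p
  rw [← finsum_mem_eq_of_bijOn (f := fun v => ∏ i, (ρ i a₀ + φ i v)) _ (hbij.comp hg)
    fun v _ => Finset.prod_congr rfl fun i _ => by simp [φ], finsum_mem_univ,
    finsum_eq_sum_of_fintype]
  refine sum_prod_add_linearMap_zmod_eq_zero _ φ ?_
  rwa [hrank, Fintype.card_fin, mul_comm]
end

section
/- Let q be a power of a prime p and 𝔽_q the field with q elements. Let F be a commutative 𝔽_q-algebra, let s and n be natural numbers with s + n ≥ 1 and (q − 1) ∣ (s + n), and let t_1, …, t_s, γ ∈ F. Then for every natural number D with D(q − 1) ≥ s + ℓ_q(n), one has ∑_{a ∈ 𝔽_q[X] monic, deg a ≤ D} a(t_1) ⋯ a(t_s) · a(γ)^n = 0 in F. (In particular the full sum over all monic polynomials, which has only finitely many nonzero degree-contributions, vanishes.) -/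
open Polynomial in
theorem exists_list_aeval_pow_eq_prod {K F : Type*} [Field K] [Fintype K] [CommRing F]
    [Algebra K F] (n : ℕ) (γ : F) :
    ∃ l : List F, l.length = (Nat.digits (Fintype.card K) n).sum ∧
      ∀ a : K[X], aeval γ a ^ n = (l.map fun u => aeval u a).prod := by
  have hq : 1 < Fintype.card K := Fintype.one_lt_card
  induction n using Nat.strong_induction_on generalizing γ with
  | _ n ih =>
    rcases Nat.eq_zero_or_pos n with rfl | hn
    · exact ⟨[], by simp⟩
    · obtain ⟨l, hl, hprod⟩ := ih (n / Fintype.card K) (Nat.div_lt_self hn hq)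
        (γ ^ Fintype.card K)
      refine ⟨List.replicate (n % Fintype.card K) γ ++ l, ?_, fun a => ?_⟩
      · rw [Nat.digits_def' hq hn]
        simp [hl]
      · have hfrob : aeval (γ ^ Fintype.card K) a = aeval γ a ^ Fintype.card K :=
          aeval_algHom_apply (FiniteField.frobeniusAlgHom K F) γ a
        rw [List.map_append, List.prod_append, ← hprod, hfrob, ← pow_mul, List.map_replicate,
          List.prod_replicate, ← pow_add, Nat.mod_add_div]

theorem sum_prod_linear_eq_zero {K F ι σ : Type*} [Field K] [Fintype K] [CommRing F]
    [Algebra K F] [Fintype ι] [Fintype σ] [DecidableEq σ] (x : ι → σ → F)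
    (h : Fintype.card ι < (Fintype.card K - 1) * Fintype.card σ) :
    ∑ v : σ → K, ∏ i, ∑ k, v k • x i k = 0 := by
  classical
  simp_rw [Finset.prod_univ_sum, Fintype.piFinset_univ]
  rw [Finset.sum_comm]
  refine Finset.sum_eq_zero fun κ _ => ?_
  have key : ∑ v : σ → K, ∏ i, v (κ i) = 0 := by
    have := MvPolynomial.sum_eval_eq_zero (K := K) (∏ i, MvPolynomial.X (κ i)) (by
      refine lt_of_le_of_lt (MvPolynomial.totalDegree_finsetProd _ _) ?_
      simpa using h)
    simpa [map_prod] using this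
  simp_rw [Finset.prod_smul]
  rw [← Finset.sum_smul, key, zero_smul]

open Polynomial in
theorem mem_image_sum_monomial_iff {K : Type*} [Field K] [Fintype K] [DecidableEq K[X]]
    (D : ℕ) (a : K[X]) :
    a ∈ Finset.univ.image (fun v : Fin (D + 1) → K => ∑ k, v k • (X : K[X]) ^ (k : ℕ)) ↔
      a.natDegree ≤ D := by
  simp only [Finset.mem_image, Finset.mem_univ, true_and]
  constructor
  · rintro ⟨v, rfl⟩
    refine natDegree_sum_le_of_forall_le _ _ fun k _ => (natDegree_smul_le _ _).trans ?_
    rw [natDegree_X_pow]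
    exact Nat.lt_succ_iff.mp k.2
  · intro h
    refine ⟨fun k => a.coeff k, ?_⟩
    rw [Fin.sum_univ_eq_sum_range (fun k => a.coeff k • (X : K[X]) ^ k)]
    conv_rhs => rw [a.as_sum_range' (D + 1) (Nat.lt_succ_of_le h)]
    simp [smul_X_eq_monomial]

open Polynomial in
theorem injective_sum_monomial {K : Type*} [Field K] (m : ℕ) :
    Function.Injective (fun v : Fin m → K => ∑ k, v k • (X : K[X]) ^ (k : ℕ)) := by
  intro v w h
  ext k
  have := congrArg (fun a => coeff a k) h
  simpa [finsetSum_coeff, coeff_X_pow, Fin.val_inj] using this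

open Polynomial in
theorem sum_monic_prod_aeval_eq_zero {K F ι : Type*} [Field K] [Fintype K] [CommRing F]
    [Algebra K F] [Fintype ι] [Nonempty ι] (u : ι → F) (D : ℕ)
    (hdvd : Fintype.card K - 1 ∣ Fintype.card ι)
    (hle : Fintype.card ι ≤ D * (Fintype.card K - 1)) :
    ∑ᶠ a ∈ {a : K[X] | a.Monic ∧ a.natDegree ≤ D}, ∏ i, aeval (u i) a = 0 := by
  classical
  have hq : 1 < Fintype.card K := Fintype.one_lt_card
  set A := Finset.univ.image (fun v : Fin (D + 1) → K => ∑ k, v k • (X : K[X]) ^ (k : ℕ)) with hA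
  have memA : ∀ a, a ∈ A ↔ a.natDegree ≤ D := mem_image_sum_monomial_iff D
  have hall : ∑ a ∈ A, ∏ i, aeval (u i) a = 0 := by
    rw [hA, Finset.sum_image (injective_sum_monomial _).injOn]
    simp only [map_sum, map_smul, map_pow, aeval_X]
    refine sum_prod_linear_eq_zero (fun i (k : Fin (D + 1)) => u i ^ (k : ℕ)) ?_
    rw [Fintype.card_fin, mul_comm, Nat.succ_mul]
    omega
  have hzero : ∑ a ∈ A with a ≠ 0, ∏ i, aeval (u i) a = 0 := by
    rw [← hall]
    refine Finset.sum_filter_of_ne fun a _ ha h0 => ha ?_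
    simp [h0]
  have hset : {a : K[X] | a.Monic ∧ a.natDegree ≤ D} = ↑(A.filter Monic) := by
    ext a
    simp [memA, and_comm]
  rw [hset, finsum_mem_coe_finset]
  have hscale : ∑ a ∈ A with a ≠ 0, ∏ i, aeval (u i) a =
      ∑ x ∈ (Finset.univ : Finset Kˣ) ×ˢ A.filter Monic, ∏ i, aeval (u i) x.2 := by
    symm
    refine Finset.sum_bij (fun x _ => x.1.val • x.2) ?_ ?_ ?_ ?_
    · rintro ⟨c, a⟩ hx
      simp only [Finset.mem_product, Finset.mem_univ, Finset.mem_filter, true_and, memA] at hx ⊢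
      exact ⟨(natDegree_smul_le _ _).trans hx.1, smul_ne_zero c.ne_zero hx.2.ne_zero⟩
    · rintro ⟨c, a⟩ hx ⟨d, b⟩ hy h
      simp only [Finset.mem_product, Finset.mem_univ, Finset.mem_filter, true_and] at hx hy h
      have hcd : (c : K) = d := by
        have := congrArg leadingCoeff h
        simpa [smul_eq_C_mul, hx.2.leadingCoeff, hy.2.leadingCoeff] using this
      rw [hcd] at h
      exact Prod.ext (Units.ext hcd) (smul_right_injective _ d.ne_zero h)
    · intro a ha
      simp only [Finset.mem_filter, memA] at ha
      have hlc : a.leadingCoeff ≠ 0 := leadingCoeff_ne_zero.mpr ha.2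
      refine ⟨(Units.mk0 _ hlc, a.leadingCoeff⁻¹ • a), ?_, ?_⟩
      · simp only [Finset.mem_product, Finset.mem_univ, Finset.mem_filter, true_and, memA]
        refine ⟨(natDegree_smul_le _ _).trans ha.1, ?_⟩
        simp [Monic, smul_eq_C_mul, hlc]
      · simp [smul_smul, hlc]
    · rintro ⟨c, a⟩ _
      obtain ⟨m, hm⟩ := hdvd
      simp [Finset.prod_smul, hm, pow_mul, FiniteField.pow_card_sub_one_eq_one (c : K) c.ne_zero]
  rw [hscale, Finset.sum_product] at hzero
  dsimp only at hzero
  rw [Finset.sum_const, Finset.card_univ, Fintype.card_units,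
    ← Nat.cast_smul_eq_nsmul K, Nat.cast_sub hq.le, FiniteField.cast_card_eq_zero] at hzero
  simpa using hzero

/-- Let `q = p^f`, `𝔽_q` the field with `q` elements, `F` a commutative
`𝔽_q`-algebra, `s, n ∈ ℕ` with `s + n ≥ 1` and `(q - 1) ∣ (s + n)`, and
`t₁, …, t_s, γ ∈ F`. Then for every `D` with `D (q - 1) ≥ s + ℓ_q(n)`,
`∑_{a monic, deg a ≤ D} a(t₁) ⋯ a(t_s) · a(γ)^n = 0` in `F`. -/
theorem stmt_8 (p f q : ℕ) (hp : p.Prime) (hf : 0 < f) (hq : q = p ^ f)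
    (Fq : Type*) [Field Fq] [Fintype Fq] (hcard : Fintype.card Fq = q)
    (F : Type*) [CommRing F] [Algebra Fq F]
    (s n : ℕ) (hsn : 1 ≤ s + n) (hdvd : (q - 1) ∣ (s + n))
    (t : Fin s → F) (γ : F) (D : ℕ)
    (hD : s + (Nat.digits q n).sum ≤ D * (q - 1)) :
    ∑ᶠ a ∈ {a : Polynomial Fq | a.Monic ∧ a.natDegree ≤ D},
      (∏ i, Polynomial.aeval (t i) a) * (Polynomial.aeval γ a) ^ n = 0 := by
  subst hcard
  obtain ⟨l, hl, hprod⟩ := exists_list_aeval_pow_eq_prod (K := Fq) n γ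
  have hq : 1 < Fintype.card Fq := Fintype.one_lt_card
  have hmod : (Nat.digits (Fintype.card Fq) n).sum ≡ n [MOD Fintype.card Fq - 1] := by
    have := Nat.ofDigits_modEq' 1 (Fintype.card Fq) (Fintype.card Fq - 1)
      ((Nat.modEq_iff_dvd' hq.le).mpr dvd_rfl) (Nat.digits (Fintype.card Fq) n)
    rwa [Nat.ofDigits_one, Nat.ofDigits_digits] at this
  have hpos : 0 < s + l.length := by
    by_contra! h
    have hn : n ≠ 0 := by omega
    have hlast := List.single_le_sum (l := Nat.digits (Fintype.card Fq) n) (by simp) _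
      (List.getLast_mem (Nat.digits_ne_nil_iff_ne_zero.mpr hn))
    have := Nat.getLast_digit_ne_zero (Fintype.card Fq) hn
    omega
  have : Nonempty (Fin s ⊕ Fin l.length) := by
    rw [← Fintype.card_pos_iff]
    simpa using hpos
  have main := sum_monic_prod_aeval_eq_zero (K := Fq) (Sum.elim t l.get) D
    (by
      simp only [Fintype.card_sum, Fintype.card_fin, hl]
      exact ((hmod.add_left s).dvd_iff dvd_rfl).mpr hdvd)
    (by simpa [hl] using hD)
  simp only [Fintype.prod_sum_type, Sum.elim_inl, Sum.elim_inr] at main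
  rw [← main]
  refine finsum_congr fun a => finsum_congr fun _ => ?_
  rw [hprod a, ← Fin.prod_univ_fun_getElem]
  rfl
end

section
/- Let p be a prime, q = p^f, and 𝔽_q the field with q elements. Let F be a field of characteristic p, let s ≥ 1 be an integer, and for i = 1, …, s let ρ_i : 𝔽_q[X] → F be a ring homomorphism. Assume that ∏_{i=1}^s ρ_i(ζ) = 1 for every ζ ∈ 𝔽_q^× (viewing ζ as a constant polynomial). Then for every natural number D with D · f · (p − 1) ≥ s, one has ∑_{a ∈ 𝔽_q[X] monic, deg a ≤ D} ρ_1(a) ⋯ ρ_s(a) = 0 in F. -/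
/-- A product of fewer than `(p - 1) * dim V` additive maps sums to zero over a finite
`ZMod p`-vector space `V`. -/
theorem sum_prod_addMonoidHom_eq_zero_of_card_lt_finrank {p : ℕ} [Fact p.Prime]
    {V F ι : Type*} [AddCommGroup V] [Module (ZMod p) V] [Fintype V] [Field F] [CharP F p]
    [Fintype ι] (L : ι → V →+ F)
    (h : Fintype.card ι < Module.finrank (ZMod p) V * (p - 1)) :
    ∑ v, ∏ i, L i v = 0 := by
  classical
  let : Algebra (ZMod p) F := ZMod.algebra F p
  let b := Module.finBasis (ZMod p) V
  rw [← b.equivFun.symm.toEquiv.sum_comp]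
  have expand (x : Fin (Module.finrank (ZMod p) V) → ZMod p) :
      ∏ i, L i (b.equivFun.symm x) = ∑ φ : ι → Fin (Module.finrank (ZMod p) V),
        algebraMap (ZMod p) F (∏ i, x (φ i)) * ∏ i, L i (b (φ i)) := by
    simp_rw [Module.Basis.equivFun_symm_apply, map_sum, ZMod.map_smul, Algebra.smul_def,
      Finset.prod_univ_sum, Fintype.piFinset_univ, Finset.prod_mul_distrib, map_prod]
  simp only [LinearEquiv.coe_toEquiv, expand]
  rw [Finset.sum_comm]
  refine Finset.sum_eq_zero fun φ _ ↦ ?_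
  rw [← Finset.sum_mul, ← map_sum]
  have key := MvPolynomial.sum_eval_eq_zero
    (∏ i, MvPolynomial.X (φ i) : MvPolynomial (Fin (Module.finrank (ZMod p) V)) (ZMod p)) (by
      refine (MvPolynomial.totalDegree_finsetProd _ _).trans_lt ?_
      simpa [MvPolynomial.totalDegree_X, ZMod.card, mul_comm] using h)
  simp only [map_prod, MvPolynomial.eval_X] at key
  rw [key, map_zero, zero_mul]

/-- A product of fewer than `n * (p - 1)` additive maps sums to zero over an elementary abelian
`p`-group of order `p ^ n`. -/
theorem sum_prod_addMonoidHom_eq_zero {p n : ℕ} [Fact p.Prime] {V F ι : Type*} [AddCommGroup V]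
    [Fintype V] [Field F] [CharP F p] [Fintype ι] (hV : ∀ x : V, p • x = 0)
    (hcard : Fintype.card V = p ^ n) (L : ι → V →+ F) (h : Fintype.card ι < n * (p - 1)) :
    ∑ v, ∏ i, L i v = 0 := by
  let : Module (ZMod p) V := AddCommGroup.zmodModule hV
  have hn : Module.finrank (ZMod p) V = n := by
    have := Module.card_eq_pow_finrank (K := ZMod p) (V := V)
    rw [ZMod.card, hcard] at this
    exact (Nat.pow_right_injective (Fact.out : p.Prime).two_le this).symm
  exact sum_prod_addMonoidHom_eq_zero_of_card_lt_finrank L (hn ▸ h)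

open Polynomial in
/-- Summing a function invariant under scaling by constants over the nonzero polynomials of a
bounded degree gives minus its sum over the monic ones. -/
theorem sum_ne_zero_eq_neg_sum_monic {K F : Type*} [Field K] [Fintype K] [Ring F]
    (hK : (Fintype.card K : F) = 0) {D : ℕ} {M N : Finset K[X]}
    (hM : ∀ a, a ∈ M ↔ a.Monic ∧ a.natDegree ≤ D)
    (hN : ∀ a, a ∈ N ↔ a ≠ 0 ∧ a.natDegree ≤ D) (g : K[X] → F)
    (hg : ∀ ζ : K, ζ ≠ 0 → ∀ a, g (C ζ * a) = g a) :
    ∑ a ∈ N, g a = -∑ a ∈ M, g a := by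
  classical
  have hsum : ∑ x ∈ M ×ˢ (Finset.univ : Finset Kˣ), g x.1 = ∑ a ∈ N, g a := by
    refine Finset.sum_bij (fun x _ ↦ C (x.2 : K) * x.1) ?_ ?_ ?_ ?_
    · rintro ⟨m, u⟩ h
      simp only [Finset.mem_product, Finset.mem_univ, and_true, hM] at h
      rw [hN, natDegree_C_mul u.ne_zero]
      exact ⟨mul_ne_zero (C_ne_zero.2 u.ne_zero) h.1.ne_zero, h.2⟩
    · rintro ⟨m, u⟩ h ⟨m', u'⟩ h' e
      simp only [Finset.mem_product, Finset.mem_univ, and_true, hM] at h h'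
      have hu : u = u' := by
        have := congrArg leadingCoeff e
        simpa [h.1.leadingCoeff, h'.1.leadingCoeff, Units.ext_iff] using this
      subst hu
      simpa using e
    · intro a ha
      rw [hN] at ha
      have hl := leadingCoeff_ne_zero.2 ha.1
      refine ⟨(C a.leadingCoeff⁻¹ * a, Units.mk0 _ hl), ?_, ?_⟩
      · simp only [Finset.mem_product, Finset.mem_univ, and_true, hM]
        rw [natDegree_C_mul (inv_ne_zero hl), mul_comm]
        exact ⟨monic_mul_leadingCoeff_inv ha.1, ha.2⟩
      · simp [← mul_assoc, ← C_mul, hl]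
    · rintro ⟨m, u⟩ -
      exact (hg _ u.ne_zero _).symm
  rw [← hsum, Finset.sum_product]
  have hunits : (Fintype.card Kˣ : F) = -1 := by
    rw [Fintype.card_units, Nat.cast_sub Fintype.card_pos, hK]
    simp
  simp [hunits]

/-- Let `q = p^f`, `𝔽_q` the field with `q` elements, `F` a field of
characteristic `p`, `s ≥ 1`, and `ρ₁, …, ρ_s : 𝔽_q[X] → F` ring homomorphisms with
`∏ i, ρ i ζ = 1` for every nonzero constant `ζ ∈ 𝔽_q^×`. Then for every `D` with
`D · f · (p - 1) ≥ s`, `∑_{a monic, deg a ≤ D} ρ₁(a) ⋯ ρ_s(a) = 0` in `F`. -/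
theorem stmt_9 (p f q : ℕ) (hp : p.Prime) (hf : 0 < f) (hq : q = p ^ f)
    (Fq : Type*) [Field Fq] [Fintype Fq] (hcard : Fintype.card Fq = q)
    (F : Type*) [Field F] [CharP F p]
    (s : ℕ) (hs : 1 ≤ s) (ρ : Fin s → Polynomial Fq →+* F)
    (hρ : ∀ ζ : Fq, ζ ≠ 0 → ∏ i, ρ i (Polynomial.C ζ) = 1)
    (D : ℕ) (hD : s ≤ D * f * (p - 1)) :
    ∑ᶠ a ∈ {a : Polynomial Fq | a.Monic ∧ a.natDegree ≤ D},
      ∏ i, ρ i a = 0 := by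
  classical
  have : Fact p.Prime := ⟨hp⟩
  have hqF : (Fintype.card Fq : F) = 0 := by
    rw [hcard, hq, Nat.cast_pow, CharP.cast_eq_zero, zero_pow hf.ne']
  have hpFq : (p : Fq) = 0 := by
    have h : (Fintype.card Fq : Fq) = 0 := Nat.cast_card_eq_zero Fq
    rw [hcard, hq, Nat.cast_pow] at h
    exact pow_eq_zero_iff hf.ne' |>.1 h
  let e := Polynomial.degreeLTEquiv Fq (D + 1)
  let : Fintype (Polynomial.degreeLT Fq (D + 1)) := Fintype.ofEquiv _ e.toEquiv.symm
  have htotal := sum_prod_addMonoidHom_eq_zero (p := p) (n := f * (D + 1))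
    (V := Polynomial.degreeLT Fq (D + 1))
    (fun x ↦ by rw [← Nat.cast_smul_eq_nsmul Fq, hpFq, zero_smul])
    (by rw [Fintype.card_congr e.toEquiv, Fintype.card_fun, Fintype.card_fin, hcard, hq, pow_mul])
    (fun i ↦ (ρ i).toAddMonoidHom.comp (Polynomial.degreeLT Fq (D + 1)).subtype.toAddMonoidHom)
    (by
      have h : 0 < f * (p - 1) := Nat.mul_pos hf (Nat.sub_pos_of_lt hp.one_lt)
      rw [Fintype.card_fin]
      nlinarith)
  let P : Finset (Polynomial Fq) :=
    (Finset.univ : Finset (Polynomial.degreeLT Fq (D + 1))).map (Function.Embedding.subtype _)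
  have hP (a : Polynomial Fq) : a ∈ P ↔ a.natDegree ≤ D := by
    have : a ∈ Polynomial.degreeLT Fq (D + 1) ↔ a.natDegree ≤ D := by
      rw [Polynomial.degreeLT_succ_eq_degreeLE, Polynomial.mem_degreeLE,
        Polynomial.natDegree_le_iff_degree_le]
    simp [P, this]
  have hPsum : ∑ a ∈ P, ∏ i, ρ i a = 0 := by
    simpa [P] using htotal
  have hzero : ∏ i, ρ i 0 = 0 := by
    simpa using Nat.one_le_iff_ne_zero.1 hs
  rw [finsum_mem_eq_finite_toFinset_sum _
    (P.finite_toSet.subset fun a ha ↦ (hP a).2 ha.2), ← neg_eq_zero]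
  rw [← sum_ne_zero_eq_neg_sum_monic (N := P.erase 0) hqF (D := D) (by simp) (by simp [hP])
    (fun a ↦ ∏ i, ρ i a)
    (fun ζ hζ a ↦ by simp only [map_mul, Finset.prod_mul_distrib, hρ ζ hζ, one_mul])]
  rw [Finset.sum_erase (f := fun a ↦ ∏ i, ρ i a) _ hzero, hPsum]
end

section
/- Let q be a power of a prime p and 𝔽_q the field with q elements. Let F be a field equipped with a nontrivial nonarchimedean multiplicative absolute value ‖·‖ with respect to which F is complete, and suppose F is an 𝔽_q-algebra. Let y ∈ F with ‖y‖ > 1, let s be a natural number, let n ∈ ℤ, and let t_1, …, t_s, z ∈ F satisfy (∏_{i=1}^s max(1, ‖t_i‖)) · ‖y‖^{−n} · ‖z‖ < 1. Then the family over monic irreducible polynomials P ∈ 𝔽_q[X] of factors (1 − P(t_1) ⋯ P(t_s) · P(y)^{−n} · z^{deg P})^{−1} is multipliable, the family over all monic a ∈ 𝔽_q[X] of terms a(t_1) ⋯ a(t_s) · a(y)^{−n} · z^{deg a} is summable, and ∑_{a monic} a(t_1) ⋯ a(t_s) · a(y)^{−n} · z^{deg a} = ∏_{P monic irreducible} (1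 − P(t_1) ⋯ P(t_s) · P(y)^{−n} · z^{deg P})^{−1} (Euler product for the twisted zeta function). -/
open Polynomial Filter Topology

section MonicEulerProduct

variable {k : Type*} [Field k]

/-- The monic polynomials all of whose monic irreducible factors lie in `S`. -/
def monicFactored (S : Finset {P : k[X] // P.Monic ∧ Irreducible P}) :
    Set {a : k[X] // a.Monic} :=
  {a | ∀ P : {P : k[X] // P.Monic ∧ Irreducible P}, P.1 ∣ a.1 → P ∈ S}

theorem monicFactored_empty :
    monicFactored (∅ : Finset {P : k[X] // P.Monic ∧ Irreducible P}) = {⟨1, monic_one⟩} := by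
  ext ⟨a, ha⟩
  simp only [monicFactored, Set.mem_ofPred_eq, Finset.notMem_empty, Set.mem_singleton_iff,
    Subtype.mk.injEq, imp_false]
  constructor
  · intro h
    by_contra h1
    obtain ⟨P, hPm, hPi, hPa⟩ :=
      exists_monic_irreducible_factor a (fun hu => h1 (ha.eq_one_of_isUnit hu))
    exact h ⟨P, hPm, hPi⟩ hPa
  · rintro rfl P hP
    exact P.2.2.not_isUnit (isUnit_of_dvd_one hP)

theorem monicFactored_insert [DecidableEq {P : k[X] // P.Monic ∧ Irreducible P}]
    {S : Finset {P : k[X] // P.Monic ∧ Irreducible P}}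
    {P : {P : k[X] // P.Monic ∧ Irreducible P}} :
    monicFactored (insert P S) = monicFactored S ∪
      (fun a : {a : k[X] // a.Monic} => (⟨P.1 * a.1, P.2.1.mul a.2⟩ : {a : k[X] // a.Monic})) ''
        monicFactored (insert P S) := by
  ext a
  constructor
  · intro h
    by_cases hPa : P.1 ∣ a.1
    · obtain ⟨b, hb⟩ := hPa
      have hbm : b.Monic := P.2.1.of_mul_monic_left (hb ▸ a.2)
      exact Or.inr ⟨⟨b, hbm⟩, fun Q hQ => h Q (hb ▸ hQ.mul_left _), Subtype.ext hb.symm⟩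
    · refine Or.inl fun Q hQ => ?_
      rcases Finset.mem_insert.1 (h Q hQ) with rfl | hQS
      · exact absurd hQ hPa
      · exact hQS
  · rintro (h | ⟨b, hb, rfl⟩) Q hQ
    · exact Finset.mem_insert_of_mem (h Q hQ)
    · rcases Q.2.2.prime.dvd_or_dvd hQ with hQP | hQb
      · have : Q = P := Subtype.ext <| eq_of_monic_of_associated Q.2.1 P.2.1 <|
          Q.2.2.associated_of_dvd P.2.2 hQP
        exact this ▸ Finset.mem_insert_self _ _
      · exact hb Q hQb

theorem disjoint_monicFactored_image_mul
    {S T : Finset {P : k[X] // P.Monic ∧ Irreducible P}}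
    {P : {P : k[X] // P.Monic ∧ Irreducible P}} (hP : P ∉ S) :
    Disjoint (monicFactored S)
      ((fun a : {a : k[X] // a.Monic} =>
        (⟨P.1 * a.1, P.2.1.mul a.2⟩ : {a : k[X] // a.Monic})) '' monicFactored T) := by
  rw [Set.disjoint_right]
  rintro _ ⟨b, -, rfl⟩ h
  exact hP (h P (dvd_mul_right _ _))

variable {F : Type*} [NormedField F] [CompleteSpace F] {φ : k[X] → F}

theorem tsum_monicFactored_eq_prod (h1 : φ 1 = 1)
    (hmul : ∀ a b : k[X], a.Monic → b.Monic → φ (a * b) = φ a * φ b)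
    (hsum : Summable fun a : {a : k[X] // a.Monic} => φ a.1)
    (hne : ∀ P : k[X], P.Monic → Irreducible P → φ P ≠ 1)
    (S : Finset {P : k[X] // P.Monic ∧ Irreducible P}) :
    ∑' a : monicFactored S, φ a.1.1 = ∏ P ∈ S, (1 - φ P.1)⁻¹ := by
  classical
  induction S using Finset.induction_on with
  | empty =>
    rw [monicFactored_empty, Finset.prod_empty, tsum_singleton
      (⟨1, monic_one⟩ : {a : k[X] // a.Monic}) (fun a => φ a.1), h1]
  | insert P S hP ih =>
    rw [Finset.prod_insert hP, ← ih, eq_inv_mul_iff_mul_eq₀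
      (sub_ne_zero.2 (hne P.1 P.2.1 P.2.2).symm), sub_mul, one_mul, sub_eq_iff_eq_add]
    conv_lhs => rw [monicFactored_insert]
    have hinj : Function.Injective (fun a : {a : k[X] // a.Monic} =>
        (⟨P.1 * a.1, P.2.1.mul a.2⟩ : {a : k[X] // a.Monic})) := fun a b h =>
      Subtype.ext (mul_left_cancel₀ P.2.1.ne_zero (congrArg Subtype.val h))
    rw [Summable.tsum_union_disjoint (f := fun a : {a : k[X] // a.Monic} => φ a.1)
      (disjoint_monicFactored_image_mul hP) (hsum.subtype _) (hsum.subtype _),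
      tsum_image (fun a : {a : k[X] // a.Monic} => φ a.1) hinj.injOn, ← tsum_mul_left]
    simp only [hmul _ _ P.2.1 (Subtype.prop _)]

/-- Euler product over the monic irreducible polynomials, for an unconditionally summable function
that is completely multiplicative on monic polynomials. -/
theorem hasProd_monic_irreducible (h1 : φ 1 = 1)
    (hmul : ∀ a b : k[X], a.Monic → b.Monic → φ (a * b) = φ a * φ b)
    (hsum : Summable fun a : {a : k[X] // a.Monic} => φ a.1)
    (hne : ∀ P : k[X], P.Monic → Irreducible P → φ P ≠ 1) :
    HasProd (fun P : {P : k[X] // P.Monic ∧ Irreducible P} => (1 - φ P.1)⁻¹)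
      (∑' a : {a : k[X] // a.Monic}, φ a.1) := by
  classical
  have hfin (a : {a : k[X] // a.Monic}) :
      {P : {P : k[X] // P.Monic ∧ Irreducible P} | P.1 ∣ a.1}.Finite := by
    refine Set.Finite.of_finite_image (f := Subtype.val) ?_ Subtype.val_injective.injOn
    refine (UniqueFactorizationMonoid.normalizedFactors a.1).toFinset.finite_toSet.subset ?_
    rintro _ ⟨P, hP, rfl⟩
    simp only [Finset.mem_coe, Multiset.mem_toFinset]
    exact (UniqueFactorizationMonoid.mem_normalizedFactors_iff' a.2.ne_zero).2
      ⟨P.2.2, P.2.1.normalize_eq_self, hP⟩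
  simp only [HasProd, SummationFilter.unconditional_filter]
  simp_rw [← tsum_monicFactored_eq_prod h1 hmul hsum hne]
  rw [Metric.tendsto_atTop]
  intro ε hε
  obtain ⟨T, hT⟩ := hsum.tsum_vanishing (Metric.ball_mem_nhds 0 hε)
  refine ⟨T.biUnion fun a => (hfin a).toFinset, fun S hS => ?_⟩
  have hsplit : ∑' a : monicFactored S, φ a.1.1 + ∑' a : ↥(monicFactored S)ᶜ, φ a.1.1 =
      ∑' a : {a : k[X] // a.Monic}, φ a.1 :=
    (hsum.subtype (monicFactored S)).tsum_add_tsum_compl (hsum.subtype (monicFactored S)ᶜ)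
  have hd : Disjoint (monicFactored S)ᶜ (T : Set {a : k[X] // a.Monic}) := by
    rw [Set.disjoint_right]
    intro a ha h
    exact h fun P hP => hS (Finset.mem_biUnion.2 ⟨a, ha, (hfin a).mem_toFinset.2 hP⟩)
  have := hT _ hd
  rw [mem_ball_zero_iff] at this
  rwa [dist_comm, dist_eq_norm, ← hsplit, add_sub_cancel_left]

end MonicEulerProduct

section Ultrametric

variable {k : Type*} [Field k] [Fintype k] {F : Type*} [NormedField F] [Algebra k F]

theorem norm_algebraMap_le_one_of_fintype (c : k) : ‖algebraMap k F c‖ ≤ 1 := by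
  rcases eq_or_ne c 0 with rfl | hc
  · simp
  · refine (pow_le_one_iff_of_nonneg (n := Fintype.card k - 1) (norm_nonneg _)
      (Nat.sub_pos_of_lt Fintype.one_lt_card).ne').1 ?_
    rw [← norm_pow, ← map_pow, FiniteField.pow_card_sub_one_eq_one c hc, map_one, norm_one]

variable [IsUltrametricDist F]

theorem norm_aeval_le_max_one_pow (a : k[X]) (t : F) :
    ‖aeval t a‖ ≤ max 1 ‖t‖ ^ a.natDegree := by
  rw [aeval_eq_sum_range]
  refine IsUltrametricDist.norm_sum_le_of_forall_le_of_nonneg (by positivity) fun i hi => ?_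
  rw [Algebra.smul_def, norm_mul, norm_pow]
  calc ‖algebraMap k F (a.coeff i)‖ * ‖t‖ ^ i ≤ 1 * max 1 ‖t‖ ^ i := by
        gcongr
        · exact norm_algebraMap_le_one_of_fintype _
        · exact le_max_right _ _
    _ ≤ max 1 ‖t‖ ^ a.natDegree := by
        rw [one_mul]
        exact pow_le_pow_right₀ (le_max_left _ _) (Nat.lt_succ_iff.1 (Finset.mem_range.1 hi))

theorem norm_aeval_of_monic {a : k[X]} (ha : a.Monic) {y : F} (hy : 1 < ‖y‖) :
    ‖aeval y a‖ = ‖y‖ ^ a.natDegree := by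
  rcases Nat.eq_zero_or_pos a.natDegree with h0 | hpos
  · simp [ha.natDegree_eq_zero.1 h0]
  · have hlt : ‖∑ i ∈ Finset.range a.natDegree, a.coeff i • y ^ i‖ < ‖y ^ a.natDegree‖ := by
      refine lt_of_le_of_lt (IsUltrametricDist.norm_sum_le_of_forall_le_of_nonneg
        (C := ‖y‖ ^ (a.natDegree - 1)) (by positivity) fun i hi => ?_) ?_
      · rw [Algebra.smul_def, norm_mul, norm_pow, ← one_mul (‖y‖ ^ (a.natDegree - 1))]
        gcongr
        · exact norm_algebraMap_le_one_of_fintype _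
        · exact hy.le
        · exact Nat.le_sub_one_of_lt (Finset.mem_range.1 hi)
      · rw [norm_pow]
        exact pow_lt_pow_right₀ hy (Nat.sub_one_lt hpos.ne')
    rw [aeval_eq_sum_range, Finset.sum_range_succ, ha.coeff_natDegree, one_smul,
      IsUltrametricDist.norm_add_eq_max_of_norm_ne_norm hlt.ne, max_eq_right hlt.le, norm_pow]

end Ultrametric

theorem finite_setOf_natDegree_le (k : Type*) [Field k] [Finite k] (N : ℕ) :
    {a : k[X] | a.natDegree ≤ N}.Finite := by
  refine Set.Finite.of_finite_image (f := fun a (i : Fin (N + 1)) => a.coeff i)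
    (Set.toFinite _) fun a ha b hb h => ?_
  ext i
  rcases lt_or_ge i (N + 1) with hi | hi
  · exact congrFun h ⟨i, hi⟩
  · rw [coeff_eq_zero_of_natDegree_lt (ha.trans_lt hi), coeff_eq_zero_of_natDegree_lt
      (hb.trans_lt hi)]

theorem summable_of_norm_le_pow_natDegree {k : Type*} [Field k] [Finite k] {F : Type*}
    [NormedField F] [CompleteSpace F] [IsUltrametricDist F] {s : Set k[X]} {φ : s → F}
    {c : ℝ} (hc0 : 0 ≤ c) (hc1 : c < 1) (hφ : ∀ a : s, ‖φ a‖ ≤ c ^ a.1.natDegree) :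
    Summable φ := by
  refine NonarchimedeanAddGroup.summable_of_tendsto_cofinite_zero ?_
  refine squeeze_zero_norm hφ ((tendsto_pow_atTop_nhds_zero_of_lt_one hc0 hc1).comp ?_)
  refine tendsto_atTop.2 fun N => ?_
  filter_upwards [((finite_setOf_natDegree_le k N).preimage
    Subtype.val_injective.injOn).compl_mem_cofinite] with a ha
  exact le_of_not_ge fun h => ha h

/-- Euler product. Let `F` be a complete nontrivially valued
nonarchimedean field which is an `𝔽_q`-algebra, `y ∈ F` with `‖y‖ > 1`, `n ∈ ℤ`,
`t₁,…,t_s, z ∈ F` with `(∏ i max(1,‖t_i‖)) · ‖y‖^{-n} · ‖z‖ < 1`. Then the Euler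
factors over monic irreducible `P` are multipliable, the terms over monic `a` are
summable, and
`∑_{a monic} a(t₁)⋯a(t_s) a(y)^{-n} z^{deg a}
  = ∏_{P monic irred} (1 - P(t₁)⋯P(t_s) P(y)^{-n} z^{deg P})⁻¹`. -/
theorem stmt_18 (p f q : ℕ) (hp : p.Prime) (hf : 0 < f) (hq : q = p ^ f)
    (Fq : Type*) [Field Fq] [Fintype Fq] (hcard : Fintype.card Fq = q)
    (F : Type*) [NontriviallyNormedField F] [CompleteSpace F] [IsUltrametricDist F]
    [Algebra Fq F]
    (y : F) (hy : 1 < ‖y‖)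
    (s : ℕ) (n : ℤ) (t : Fin s → F) (z : F)
    (hconv : (∏ i, max 1 ‖t i‖) * ‖y‖ ^ (-n) * ‖z‖ < 1) :
    Multipliable (fun P : {P : Polynomial Fq // P.Monic ∧ Irreducible P} =>
      (1 - (∏ i, Polynomial.aeval (t i) P.1) * (Polynomial.aeval y P.1) ^ (-n) *
        z ^ P.1.natDegree)⁻¹) ∧
    Summable (fun a : {a : Polynomial Fq // a.Monic} =>
      (∏ i, Polynomial.aeval (t i) a.1) * (Polynomial.aeval y a.1) ^ (-n) *
        z ^ a.1.natDegree) ∧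
    (∑' a : {a : Polynomial Fq // a.Monic},
        (∏ i, Polynomial.aeval (t i) a.1) * (Polynomial.aeval y a.1) ^ (-n) *
          z ^ a.1.natDegree)
      = ∏' P : {P : Polynomial Fq // P.Monic ∧ Irreducible P},
          (1 - (∏ i, Polynomial.aeval (t i) P.1) * (Polynomial.aeval y P.1) ^ (-n) *
            z ^ P.1.natDegree)⁻¹ := by
  set φ : Fq[X] → F := fun a =>
    (∏ i, aeval (t i) a) * (aeval y a) ^ (-n) * z ^ a.natDegree with hφ
  set c : ℝ := (∏ i, max 1 ‖t i‖) * ‖y‖ ^ (-n) * ‖z‖ with hc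
  have hc0 : 0 ≤ c := by positivity
  have hbound (a : Fq[X]) (ha : a.Monic) : ‖φ a‖ ≤ c ^ a.natDegree := by
    simp only [hφ, hc, norm_mul, norm_prod, norm_zpow, norm_pow, mul_pow,
      norm_aeval_of_monic ha hy]
    rw [← Finset.prod_pow, ← zpow_natCast (‖y‖ ^ (-n)), zpow_comm, zpow_natCast]
    gcongr
    exact norm_aeval_le_max_one_pow _ _
  have h1 : φ 1 = 1 := by simp [hφ]
  have hmul (a b : Fq[X]) (ha : a.Monic) (hb : b.Monic) : φ (a * b) = φ a * φ b := by
    simp only [hφ, map_mul, Finset.prod_mul_distrib, mul_zpow, ha.natDegree_mul hb, pow_add]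
    ring
  have hsum : Summable fun a : {a : Fq[X] // a.Monic} => φ a.1 :=
    summable_of_norm_le_pow_natDegree (s := {a | a.Monic}) hc0 hconv fun a => hbound a.1 a.2
  have hne (P : Fq[X]) (hP : P.Monic) (hPi : Irreducible P) : φ P ≠ 1 := by
    intro h
    have := (hbound P hP).trans_lt (pow_lt_one₀ hc0 hconv hPi.natDegree_pos.ne')
    simp [h] at this
  have hprod := hasProd_monic_irreducible h1 hmul hsum hne
  exact ⟨hprod.multipliable, hsum, hprod.tprod_eq.symm⟩
end
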